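/- Let B = [0,1]² and let ℙ be the inclined nightrider, the piece with basic moves (1,2) and (2,1). Then the denominator D(B^q, A_ℙ^q) of the inside-out polytope equals 1 if q = 1, equals 2 if q = 2, and equals 3·2^{q−1} if q ≥ 3. -/

import Mathlib

/-! Common definitions: boards, pieces, hyperplane arrangements, rank,
antipode maps, trajectories, augmentations, crossing points, denominators. -/

noncomputable section

/-- A point of the plane. -/
abbrev Pt : Type := ℝ × ℝ

/-- Dot product on `ℝ²`. -/
def dotp (u v : Pt) : ℝ := u.1 * v.1 + u.2 * v.2

/-- A board: a rational convex polygon `{z | ∀ j, a_j · z ≤ β_j}`, bounded, with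
nonempty interior, each defining line meeting the board in at least two points (an edge). -/
structure Board where
  s : ℕ
  A : Fin s → Pt
  β : Fin s → ℝ
  A_rat : ∀ j, ∃ p q : ℚ, A j = ((p : ℝ), (q : ℝ))
  β_rat : ∀ j, ∃ p : ℚ, β j = (p : ℝ)
  bounded : Bornology.IsBounded {z : Pt | ∀ j, dotp (A j) z ≤ β j}
  int_ne : (interior {z : Pt | ∀ j, dotp (A j) z ≤ β j}).Nonempty
  edges : ∀ j, ∃ u v : Pt, u ≠ v ∧ (∀ k, dotp (A k) u ≤ β k) ∧ (∀ k, dotp (A k) v ≤ β k) ∧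
    dotp (A j) u = β j ∧ dotp (A j) v = β j

/-- The set of points of the board. -/
def Board.set (Bd : Board) : Set Pt := {z | ∀ j, dotp (Bd.A j) z ≤ Bd.β j}

/-- The corners of the board: its extreme points. -/
def Board.corners (Bd : Board) : Set Pt := Set.extremePoints ℝ Bd.set

/-- A two-move rider: two nonparallel basic moves `(c r, d r)`, each with coprime entries. -/
structure Piece where
  c : Bool → ℤ
  d : Bool → ℤ
  coprime : ∀ r, Int.gcd (c r) (d r) = 1
  nonparallel : c false * d true - c true * d false ≠ 0

/-- The basic move vector of `P` of type `r`, as a vector in `ℝ²`. -/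
def Piece.mv (P : Piece) (r : Bool) : Pt := ((P.c r : ℝ), (P.d r : ℝ))

/-- The normal vector `(d_r, -c_r)` of the attack equations of type `r`. -/
def Piece.anorm (P : Piece) (r : Bool) : Pt := ((P.d r : ℝ), -(P.c r : ℝ))

/-- A configuration of `q` points in the plane; the configuration space is `ℝ^{2q}`. -/
abbrev Conf (q : ℕ) : Type := Fin q → Pt

/-- Dot product on the configuration space `ℝ^{2q}`. -/
def confDot {q : ℕ} (u w : Conf q) : ℝ := ∑ k, dotp (u k) (w k)

/-- The vector of `ℝ^{2q}` whose `i`-th planar component is `v` and all others `0`. -/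
def unitVec {q : ℕ} (i : Fin q) (v : Pt) : Conf q := fun k => if k = i then v else 0

/-- The normal vector in `ℝ^{2q}` of the attack hyperplane `(w_i - w_j) · v = 0`. -/
def attackNormal {q : ℕ} (i j : Fin q) (v : Pt) : Conf q :=
  fun k => if k = i then v else if k = j then -v else 0

/-- The hyperplane arrangement `H(z)` associated to a configuration `z`: each hyperplane
`{w | n · w = β}` is recorded as the pair `(n, β)`.  It consists of the attack hyperplanes
through `z` and the fixation hyperplanes through `z`. -/
def HArr (Bd : Board) (P : Piece) {q : ℕ} (z : Conf q) : Set (Conf q × ℝ) :=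
  {h | (∃ i j : Fin q, ∃ r : Bool, i < j ∧ dotp (z i - z j) (P.anorm r) = 0 ∧
          h = (attackNormal i j (P.anorm r), 0)) ∨
       (∃ i : Fin q, ∃ e : Fin Bd.s, dotp (Bd.A e) (z i) = Bd.β e ∧
          h = (unitVec i (Bd.A e), Bd.β e))}

/-- The rank of a configuration `z`: the dimension of the span of the normal vectors
of the hyperplanes of `H(z)`. -/
def confRank (Bd : Board) (P : Piece) {q : ℕ} (z : Conf q) : ℕ :=
  Module.finrank ℝ (Submodule.span ℝ (Prod.fst '' HArr Bd P z))

/-- A configuration has full rank when its rank is `2q`. -/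
def FullRank (Bd : Board) (P : Piece) {q : ℕ} (z : Conf q) : Prop :=
  confRank Bd P z = 2 * q

/-- `z ∈ B^q`. -/
def InBoard (Bd : Board) {q : ℕ} (z : Conf q) : Prop := ∀ i, z i ∈ Bd.set

/-- A vertex of the inside-out polytope `(B^q, A_P^q)`: a point of `B^q` that is the unique
common point of some subset of its associated hyperplane arrangement. -/
def IsVertex (Bd : Board) (P : Piece) {q : ℕ} (z : Conf q) : Prop :=
  InBoard Bd z ∧
    ∃ H' ⊆ HArr Bd P z, {w : Conf q | ∀ h ∈ H', confDot h.1 w = h.2} = {z}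

/-- The line through `b` in direction `v` meets the interior of `R`. -/
def meetsInterior (R : Set Pt) (v : Pt) (b : Pt) : Prop := ∃ t : ℝ, b + t • v ∈ interior R

/-- `b'` is the antipode of `b` in direction `v`: if the line through `b` with direction `v`
misses the interior of `R` then `b' = b`; otherwise `b'` is the second intersection point of
the line with the boundary of `R`. -/
def AntipRel (R : Set Pt) (v : Pt) (b b' : Pt) : Prop :=
  (¬ meetsInterior R v b → b' = b) ∧
  (meetsInterior R v b → b' ∈ frontier R ∧ b' ≠ b ∧ ∃ t : ℝ, b' = b + t • v)

/-- `s` is the antipode map of `R` in direction `v`. -/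
def IsAntipodeMap (R : Set Pt) (v : Pt) (s : Pt → Pt) : Prop :=
  ∀ b ∈ frontier R, AntipRel R v b (s b)

/-- The move type used at step `i` of an alternating sequence whose step `0` uses type `st`. -/
def altMove (st : Bool) (i : ℕ) : Bool := if i % 2 = 0 then st else !st

/-- A trajectory: a finite sequence `b 0, …, b (l-1)` of distinct boundary points of `R`,
each obtained from the previous by an antipode map, the move types alternating. -/
def IsTrajectory (R : Set Pt) (mv : Bool → Pt) (l : ℕ) (b : ℕ → Pt) (st : Bool) : Prop :=
  1 ≤ l ∧ (∀ i, i < l → b i ∈ frontier R) ∧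
  (∀ i j, i < l → j < l → b i = b j → i = j) ∧
  (∀ i, i + 1 < l → AntipRel R (mv (altMove st i)) (b i) (b (i + 1)))

/-- A cyclical trajectory: additionally the first point is the antipode of the last,
the move type continuing the alternation. -/
def IsCyclical (R : Set Pt) (mv : Bool → Pt) (l : ℕ) (b : ℕ → Pt) (st : Bool) : Prop :=
  IsTrajectory R mv l b st ∧ AntipRel R (mv (altMove st (l - 1))) (b (l - 1)) (b 0)

/-- The configuration `(b 1, …, b l) ∈ B^l` formed by the points of a trajectory. -/
def trajConf (l : ℕ) (b : ℕ → Pt) : Conf l := fun i => b i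

/-- A corner trajectory: a trajectory containing a corner of the board. -/
def IsCornerTraj (Bd : Board) (P : Piece) (l : ℕ) (b : ℕ → Pt) (st : Bool) : Prop :=
  IsTrajectory Bd.set P.mv l b st ∧ ∃ i, i < l ∧ b i ∈ Bd.corners

/-- A rigid cycle: a cyclical trajectory of full rank. -/
def IsRigidCycle (Bd : Board) (P : Piece) (l : ℕ) (b : ℕ → Pt) (st : Bool) : Prop :=
  IsCyclical Bd.set P.mv l b st ∧ confRank Bd P (trajConf l b) = 2 * l

/-- The trajectory can be extended backwards (the relevant antipode of its first point
is a different point). -/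
def CanExtendBack (R : Set Pt) (mv : Bool → Pt) (b : ℕ → Pt) (st : Bool) : Prop :=
  meetsInterior R (mv (altMove st 1)) (b 0)

/-- The trajectory can be extended forwards (the relevant antipode of its last point
is a different point). -/
def CanExtendFwd (R : Set Pt) (mv : Bool → Pt) (l : ℕ) (b : ℕ → Pt) (st : Bool) : Prop :=
  meetsInterior R (mv (altMove st (l - 1))) (b (l - 1))

/-- `a 0, …, a (L-1)` is the augmentation of the trajectory `b 0, …, b (l-1)`:
the trajectory with the antipode of its first point prepended whenever it differs from the
first point, and the antipode of its last point appended whenever it differs from the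
last point. -/
def IsAugmentation (R : Set Pt) (mv : Bool → Pt) (l : ℕ) (b : ℕ → Pt) (st : Bool)
    (L : ℕ) (a : ℕ → Pt) : Prop :=
  ∃ off : ℕ,
    (∀ i, i < l → a (i + off) = b i) ∧
    (CanExtendBack R mv b st → off = 1 ∧ AntipRel R (mv (altMove st 1)) (b 0) (a 0)) ∧
    (¬ CanExtendBack R mv b st → off = 0) ∧
    (CanExtendFwd R mv l b st →
      L = l + off + 1 ∧ AntipRel R (mv (altMove st (l - 1))) (b (l - 1)) (a (l + off))) ∧
    (¬ CanExtendFwd R mv l b st → L = l + off)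

/-- `c` is a crossing point of the two sequences: an interior point of `R` lying on a
segment of each. -/
def CrossingOfSeqs (R : Set Pt) (La : ℕ) (a : ℕ → Pt) (Lb : ℕ) (bb : ℕ → Pt) (c : Pt) : Prop :=
  c ∈ interior R ∧ ∃ i j, i + 1 < La ∧ j + 1 < Lb ∧
    c ∈ segment ℝ (a i) (a (i + 1)) ∧ c ∈ segment ℝ (bb j) (bb (j + 1))

/-- `c` is a self-crossing point of the sequence: an interior point of `R` lying on two
distinct segments of the sequence. -/
def SelfCrossingOfSeq (R : Set Pt) (La : ℕ) (a : ℕ → Pt) (c : Pt) : Prop :=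
  c ∈ interior R ∧ ∃ i j, i ≠ j ∧ i + 1 < La ∧ j + 1 < La ∧
    c ∈ segment ℝ (a i) (a (i + 1)) ∧ c ∈ segment ℝ (a j) (a (j + 1))

/-- `x` is a rational number whose denominator (in lowest terms) divides `D`. -/
def DenDvd (x : ℝ) (D : ℕ) : Prop := ∃ p : ℚ, (p : ℝ) = x ∧ p.den ∣ D

/-- Both coordinates of `z` are rational with denominators dividing `D`. -/
def PtDenDvd (z : Pt) (D : ℕ) : Prop := DenDvd z.1 D ∧ DenDvd z.2 D

/-- `D` is the denominator of the inside-out polytope `(B^q, A_P^q)`: the least common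
multiple of the denominators of the coordinates of all of its vertices. -/
def IsIOPDenom (Bd : Board) (P : Piece) (q : ℕ) (D : ℕ) : Prop :=
  (∀ z : Conf q, IsVertex Bd P z → ∀ i, PtDenDvd (z i) D) ∧
  (∀ D' : ℕ, (∀ z : Conf q, IsVertex Bd P z → ∀ i, PtDenDvd (z i) D') → D ∣ D')

/-- A finite family of finite sequences of points (with starting move types),
to be used as a family of trajectories. -/
structure TrajFamily where
  m : ℕ
  len : ℕ → ℕ
  pts : ℕ → ℕ → Pt
  st : ℕ → Bool

/-- Every member of the family is a trajectory. -/
def TrajFamily.Wf (F : TrajFamily) (R : Set Pt) (mv : Bool → Pt) : Prop :=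
  ∀ k, k < F.m → IsTrajectory R mv (F.len k) (F.pts k) (F.st k)

/-- The members of the family partition the set `S`: their point sets are pairwise disjoint
with union `S`. -/
def TrajFamily.Partitions (F : TrajFamily) (S : Set Pt) : Prop :=
  {p | ∃ k, k < F.m ∧ ∃ i, i < F.len k ∧ F.pts k i = p} = S ∧
  ∀ k k', k < F.m → k' < F.m → k ≠ k' →
    ∀ i i', i < F.len k → i' < F.len k' → F.pts k i ≠ F.pts k' i'

/-- The family is a partition into maximal trajectories: no point of one member is an
antipode of a point of a different member (no edge of the antipode graph joins two
distinct members). -/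
def TrajFamily.Maximal (F : TrajFamily) (R : Set Pt) (mv : Bool → Pt) : Prop :=
  ∀ k k', k < F.m → k' < F.m → k ≠ k' →
    ∀ i i', i < F.len k → i' < F.len k' →
      ∀ r : Bool, ¬ AntipRel R (mv r) (F.pts k i) (F.pts k' i')

/-- The unit square `[0,1]²`. -/
def unitSq : Set Pt := Set.Icc ((0, 0) : Pt) ((1, 1) : Pt)

end

noncomputable section

/-- The value of `2x - y`, constant along the move `(1,2)`. -/
def lineU (p : Pt) : ℝ := 2 * p.1 - p.2

/-- The value of `x - 2y`, constant along the move `(2,1)`. -/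
def lineV (p : Pt) : ℝ := p.1 - 2 * p.2

/-- `p` lies on a vertical side line of the unit square. -/
def OnVert (p : Pt) : Prop := p.1 = 0 ∨ p.1 = 1

/-- `p` lies on a horizontal side line of the unit square. -/
def OnHoriz (p : Pt) : Prop := p.2 = 0 ∨ p.2 = 1

/-- A displacement of `p` changing `lineU` by `α` and `lineV` by `β` respects the fixations
of `p` to the sides of the unit square. -/
def RespectsSides (p : Pt) (α β : ℝ) : Prop :=
  (OnVert p → 2 * α = β) ∧ (OnHoriz p → α = 2 * β)

/-- Whenever the level sets of `g` and `h` are displaced by amounts satisfying the constraint `C`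
at all points of `S`, all displacements vanish on `S`. -/
def IsRigidSet (g h : Pt → ℝ) (C : Pt → ℝ → ℝ → Prop) (S : Finset Pt) : Prop :=
  ∀ a b : ℝ → ℝ, (∀ p ∈ S, C p (a (g p)) (b (h p))) → ∀ p ∈ S, a (g p) = 0 ∧ b (h p) = 0

/-- Both coordinates of `p` are integer multiples of `2⁻ᵏ`. -/
def IsDyadicPt (k : ℕ) (p : Pt) : Prop :=
  (∃ m : ℤ, p.1 * 2 ^ k = m) ∧ ∃ m : ℤ, p.2 * 2 ^ k = m

theorem IsRigidSet.symm {g h : Pt → ℝ} {C : Pt → ℝ → ℝ → Prop} {S : Finset Pt}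
    (hS : IsRigidSet g h C S) : IsRigidSet h g (fun p α β => C p β α) S :=
  fun a b hab p hp => (hS b a hab p hp).symm

theorem IsRigidSet.erase {g h : Pt → ℝ} {C : Pt → ℝ → ℝ → Prop} {S : Finset Pt}
    (hS : IsRigidSet g h C S) {p : Pt} (huniq : ∀ p' ∈ S, g p' = g p → p' = p)
    (hC : ∀ β, ∃ α, C p α β) : IsRigidSet g h C (S.erase p) := by
  intro a b hab p' hp'
  obtain ⟨α, hα⟩ := hC (b (h p))
  have key := hS (Function.update a (g p) α) b ?_ p' (Finset.mem_of_mem_erase hp')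
  · have hne : g p' ≠ g p := fun e =>
      Finset.ne_of_mem_erase hp' (huniq p' (Finset.mem_of_mem_erase hp') e)
    simpa [Function.update_of_ne hne] using key
  · intro s hs
    by_cases hsp : s = p
    · subst hsp
      simpa using hα
    · have hne : g s ≠ g p := fun e => hsp (huniq s hs e)
      simpa [Function.update_of_ne hne] using hab s (Finset.mem_erase.2 ⟨hsp, hs⟩)

theorem IsRigidSet.exists_ne {g h : Pt → ℝ} {C : Pt → ℝ → ℝ → Prop} {S : Finset Pt}
    (hS : IsRigidSet g h C S) (hC0 : ∀ p, C p 0 0) {p : Pt} (hp : p ∈ S)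
    (huniq : ∀ p' ∈ S, g p' = g p → p' = p) (hC : ∀ β, ∃ α, C p α β) :
    ∃ p' ∈ S.erase p, h p' = h p := by
  by_contra! hno
  obtain ⟨α, hα⟩ := hC 1
  have key := hS (Function.update 0 (g p) α) (Function.update 0 (h p) 1) ?_ p hp
  · simp at key
  · intro s hs
    by_cases hsp : s = p
    · subst hsp
      simpa using hα
    · have h1 : g s ≠ g p := fun e => hsp (huniq s hs e)
      have h2 : h s ≠ h p := hno s (Finset.mem_erase.2 ⟨hsp, hs⟩)
      simpa [Function.update_of_ne h1, Function.update_of_ne h2] using hC0 s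

theorem respectsSides_zero (p : Pt) : RespectsSides p 0 0 := by
  simp [RespectsSides]

theorem IsDyadicPt.mono {k l : ℕ} (hkl : k ≤ l) {p : Pt} (hp : IsDyadicPt k p) :
    IsDyadicPt l p := by
  obtain ⟨⟨m, hm⟩, n, hn⟩ := hp
  obtain ⟨j, rfl⟩ := Nat.exists_eq_add_of_le hkl
  refine ⟨⟨m * 2 ^ j, ?_⟩, n * 2 ^ j, ?_⟩ <;> push_cast
  · rw [← hm]; ring
  · rw [← hn]; ring

theorem isDyadicPt_of_corner {p : Pt} (hx : OnVert p) (hy : OnHoriz p) (k : ℕ) :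
    IsDyadicPt k p := by
  refine IsDyadicPt.mono (Nat.zero_le k) ⟨?_, ?_⟩
  · rcases hx with h | h
    · exact ⟨0, by simp [h]⟩
    · exact ⟨1, by simp [h]⟩
  · rcases hy with h | h
    · exact ⟨0, by simp [h]⟩
    · exact ⟨1, by simp [h]⟩

/-- Moving from one boundary point to another along a move at most doubles the denominator. -/
theorem IsDyadicPt.succ_of_line {k : ℕ} {p p' : Pt} (hp' : IsDyadicPt k p')
    (hp : OnVert p ∨ OnHoriz p) (hline : lineU p' = lineU p ∨ lineV p' = lineV p) :
    IsDyadicPt (k + 1) p := by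
  obtain ⟨⟨m, hm⟩, n, hn⟩ := hp'
  simp only [lineU, lineV] at hline
  have e : (2 : ℝ) ^ (k + 1) = 2 * 2 ^ k := by ring
  have side (c : ℤ) (x : ℝ) (hx : x = c) : x * (2 * 2 ^ k) = ((c * (2 * 2 ^ k) : ℤ) : ℝ) := by
    rw [hx]; push_cast; ring
  simp only [IsDyadicPt, e]
  have hc : (∃ c : ℤ, p.1 = c) ∨ ∃ c : ℤ, p.2 = c := by
    rcases hp with (h | h) | h | h
    · exact .inl ⟨0, by simp [h]⟩
    · exact .inl ⟨1, by simp [h]⟩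
    · exact .inr ⟨0, by simp [h]⟩
    · exact .inr ⟨1, by simp [h]⟩
  rcases hc with ⟨c, hc⟩ | ⟨c, hc⟩
  · refine ⟨⟨_, side c _ hc⟩, ?_⟩
    rcases hline with h | h
    · refine ⟨2 * (2 * c * 2 ^ k - 2 * m + n), ?_⟩
      push_cast
      rw [← hm, ← hn, ← hc]
      linear_combination 2 * 2 ^ k * h
    · refine ⟨c * 2 ^ k - m + 2 * n, ?_⟩
      push_cast
      rw [← hm, ← hn, ← hc]
      linear_combination 2 ^ k * h
  · refine ⟨?_, _, side c _ hc⟩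
    rcases hline with h | h
    · refine ⟨c * 2 ^ k + 2 * m - n, ?_⟩
      push_cast
      rw [← hm, ← hn, ← hc]
      linear_combination -2 ^ k * h
    · refine ⟨2 * (2 * c * 2 ^ k + m - 2 * n), ?_⟩
      push_cast
      rw [← hm, ← hn, ← hc]
      linear_combination -2 * 2 ^ k * h

theorem mem_unitSq {p : Pt} : p ∈ unitSq ↔ (0 ≤ p.1 ∧ p.1 ≤ 1) ∧ 0 ≤ p.2 ∧ p.2 ≤ 1 := by
  simp only [unitSq, Set.mem_Icc, Prod.le_def]
  tauto

/-- Among the points of `T` that are not corners, a farthest one from the diagonal is the only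
point of `T` on one of its two move lines. -/
theorem line_unique_of_farthest {T : Finset Pt} (hsq : ∀ p ∈ T, p ∈ unitSq)
    (hbd : ∀ p ∈ T, OnVert p ∨ OnHoriz p) {p : Pt} (hp : p ∈ T)
    (hcor : ¬ (OnVert p ∧ OnHoriz p))
    (hmax : ∀ p' ∈ T, ¬ (OnVert p' ∧ OnHoriz p') → |p'.1 - p'.2| ≤ |p.1 - p.2|) :
    (∀ p' ∈ T, lineU p' = lineU p → p' = p) ∨ ∀ p' ∈ T, lineV p' = lineV p → p' = p := by
  obtain ⟨⟨hx0, hx1⟩, hy0, hy1⟩ := mem_unitSq.1 (hsq p hp)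
  have hb := hbd p hp
  obtain ⟨x, y⟩ := p
  simp only [OnVert, OnHoriz, lineU, lineV] at *
  rcases hb with (rfl | rfl) | rfl | rfl
  · have h0 : y ≠ 0 := fun h => hcor (by simp [h])
    have h1 : y ≠ 1 := fun h => hcor (by simp [h])
    have lo : 0 < y := lt_of_le_of_ne (by assumption) h0.symm
    have hi : y < 1 := lt_of_le_of_ne (by assumption) h1
    refine .inl fun p' hp' he => ?_
    obtain ⟨⟨x0, x1⟩, y0, y1⟩ := mem_unitSq.1 (hsq p' hp')
    have hb' := hbd p' hp'
    have hm := hmax p' hp'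
    obtain ⟨x', y'⟩ := p'
    dsimp only at *
    rcases hb' with (rfl | rfl) | rfl | rfl
    · exact Prod.ext rfl (by dsimp only; linarith)
    · linarith
    · linarith
    · have hn : ¬ (x' = 0 ∨ x' = 1) := by rintro (h | h) <;> linarith
      have := hm (by tauto)
      rw [abs_of_nonpos (by linarith), abs_of_nonpos (by linarith)] at this
      linarith
  · have h0 : y ≠ 0 := fun h => hcor (by simp [h])
    have h1 : y ≠ 1 := fun h => hcor (by simp [h])
    have lo : 0 < y := lt_of_le_of_ne (by assumption) h0.symm
    have hi : y < 1 := lt_of_le_of_ne (by assumption) h1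
    refine .inl fun p' hp' he => ?_
    obtain ⟨⟨x0, x1⟩, y0, y1⟩ := mem_unitSq.1 (hsq p' hp')
    have hb' := hbd p' hp'
    have hm := hmax p' hp'
    obtain ⟨x', y'⟩ := p'
    dsimp only at *
    rcases hb' with (rfl | rfl) | rfl | rfl
    · linarith
    · exact Prod.ext rfl (by dsimp only; linarith)
    · have hn : ¬ (x' = 0 ∨ x' = 1) := by rintro (h | h) <;> linarith
      have := hm (by tauto)
      rw [abs_of_nonneg (by linarith), abs_of_nonneg (by linarith)] at this
      linarith
    · linarith
  · have h0 : x ≠ 0 := fun h => hcor (by simp [h])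
    have h1 : x ≠ 1 := fun h => hcor (by simp [h])
    have lo : 0 < x := lt_of_le_of_ne (by assumption) h0.symm
    have hi : x < 1 := lt_of_le_of_ne (by assumption) h1
    refine .inr fun p' hp' he => ?_
    obtain ⟨⟨x0, x1⟩, y0, y1⟩ := mem_unitSq.1 (hsq p' hp')
    have hb' := hbd p' hp'
    have hm := hmax p' hp'
    obtain ⟨x', y'⟩ := p'
    dsimp only at *
    rcases hb' with (rfl | rfl) | rfl | rfl
    · linarith
    · have hn : ¬ (y' = 0 ∨ y' = 1) := by rintro (h | h) <;> linarith
      have := hm (by tauto)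
      rw [abs_of_nonneg (by linarith), abs_of_nonneg (by linarith)] at this
      linarith
    · exact Prod.ext (by dsimp only; linarith) rfl
    · linarith
  · have h0 : x ≠ 0 := fun h => hcor (by simp [h])
    have h1 : x ≠ 1 := fun h => hcor (by simp [h])
    have lo : 0 < x := lt_of_le_of_ne (by assumption) h0.symm
    have hi : x < 1 := lt_of_le_of_ne (by assumption) h1
    refine .inr fun p' hp' he => ?_
    obtain ⟨⟨x0, x1⟩, y0, y1⟩ := mem_unitSq.1 (hsq p' hp')
    have hb' := hbd p' hp'
    have hm := hmax p' hp'
    obtain ⟨x', y'⟩ := p'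
    dsimp only at *
    rcases hb' with (rfl | rfl) | rfl | rfl
    · have hn : ¬ (y' = 0 ∨ y' = 1) := by rintro (h | h) <;> linarith
      have := hm (by tauto)
      rw [abs_of_nonpos (by linarith), abs_of_nonpos (by linarith)] at this
      linarith
    · linarith
    · linarith
    · exact Prod.ext (by dsimp only; linarith) rfl

/-- The boundary points of a rigid set of `n` boundary points have denominators dividing
`2 ^ (n - 1)`. -/
theorem IsRigidSet.isDyadicPt {T : Finset Pt} (hsq : ∀ p ∈ T, p ∈ unitSq)
    (hbd : ∀ p ∈ T, OnVert p ∨ OnHoriz p) (hT : IsRigidSet lineU lineV RespectsSides T) :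
    ∀ p ∈ T, IsDyadicPt (T.card - 1) p := by
  induction hn : T.card using Nat.strong_induction_on generalizing T with
  | _ n ih =>
  subst hn
  by_cases hall : ∀ p ∈ T, OnVert p ∧ OnHoriz p
  · exact fun p hp => isDyadicPt_of_corner (hall p hp).1 (hall p hp).2 _
  classical
  push Not at hall
  obtain ⟨p₀, hp₀, hc₀⟩ := hall
  obtain ⟨p, hpT, hmax⟩ := (T.filter fun p => ¬ (OnVert p ∧ OnHoriz p)).exists_max_image
    (fun p => |p.1 - p.2|) ⟨p₀, by simp [hp₀]; exact hc₀⟩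
  obtain ⟨hp, hcor⟩ := Finset.mem_filter.1 hpT
  have hα (β : ℝ) : ∃ α, RespectsSides p α β := by
    by_cases hv : OnVert p
    · exact ⟨β / 2, fun _ => by ring, fun hh => absurd ⟨hv, hh⟩ hcor⟩
    · exact ⟨2 * β, fun h => absurd h hv, fun _ => rfl⟩
  have hβ (α : ℝ) : ∃ β, RespectsSides p α β := by
    by_cases hv : OnVert p
    · exact ⟨2 * α, fun _ => rfl, fun hh => absurd ⟨hv, hh⟩ hcor⟩
    · exact ⟨α / 2, fun h => absurd h hv, fun _ => by ring⟩
  have main : IsRigidSet lineU lineV RespectsSides (T.erase p) ∧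
      ∃ p' ∈ T.erase p, lineU p' = lineU p ∨ lineV p' = lineV p := by
    rcases line_unique_of_farthest hsq hbd hp hcor
      (fun p' hp' hc => hmax p' (Finset.mem_filter.2 ⟨hp', hc⟩)) with hu | hu
    · refine ⟨hT.erase hu hα, ?_⟩
      obtain ⟨p', hp', h⟩ := hT.exists_ne respectsSides_zero hp hu hα
      exact ⟨p', hp', .inr h⟩
    · refine ⟨(hT.symm.erase hu hβ).symm, ?_⟩
      obtain ⟨p', hp', h⟩ := hT.symm.exists_ne respectsSides_zero hp hu hβ
      exact ⟨p', hp', .inl h⟩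
  obtain ⟨hrig, p', hp', hline⟩ := main
  have hcard : (T.erase p).card + 1 = T.card := Finset.card_erase_add_one hp
  have hpos : 0 < (T.erase p).card := Finset.card_pos.2 ⟨p', hp'⟩
  have hd := ih (T.erase p).card (by omega)
    (fun s hs => hsq s (Finset.mem_of_mem_erase hs))
    (fun s hs => hbd s (Finset.mem_of_mem_erase hs)) hrig rfl
  intro s hs
  by_cases hsp : s = p
  · subst hsp
    exact ((hd p' hp').succ_of_line (hbd s hs) hline).mono (by omega)
  · exact (hd s (Finset.mem_erase.2 ⟨hsp, hs⟩)).mono (by omega)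

/-- A point of a rigid set is either a boundary point with the expected denominator or the
intersection of two move lines through such points. -/
theorem IsRigidSet.boundary_or_crossing {S : Finset Pt} (hsq : ∀ p ∈ S, p ∈ unitSq)
    (hS : IsRigidSet lineU lineV RespectsSides S) {p : Pt} (hp : p ∈ S) :
    IsDyadicPt (S.card - 1) p ∨
      ∃ p₁ ∈ S.erase p, ∃ p₂ ∈ S.erase p, p₁ ≠ p₂ ∧ lineU p₁ = lineU p ∧ lineV p₂ = lineV p ∧
        IsDyadicPt (S.card - 1) p₁ ∧ IsDyadicPt (S.card - 1) p₂ := by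
  classical
  set T := S.filter fun p => OnVert p ∨ OnHoriz p with hTdef
  have hTS : T ⊆ S := Finset.filter_subset _ _
  have free (s : Pt) (hs : s ∈ S) (hsT : s ∉ T) (α β : ℝ) : RespectsSides s α β := by
    have h : ¬ (OnVert s ∨ OnHoriz s) := fun h => hsT (Finset.mem_filter.2 ⟨hs, h⟩)
    exact ⟨fun h' => absurd (.inl h') h, fun h' => absurd (.inr h') h⟩
  have hT : IsRigidSet lineU lineV RespectsSides T := by
    intro a b hab s hs
    refine hS a b (fun s' hs' => ?_) s (hTS hs)
    by_cases h : s' ∈ T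
    · exact hab s' h
    · exact free s' hs' h _ _
  have hd (s : Pt) (hs : s ∈ T) : IsDyadicPt (S.card - 1) s :=
    (hT.isDyadicPt (fun s hs => hsq s (hTS hs)) (fun s hs => (Finset.mem_filter.1 hs).2)
      s hs).mono (Nat.sub_le_sub_right (Finset.card_le_card hTS) 1)
  by_cases hpT : p ∈ T
  · exact .inl (hd p hpT)
  have hU : ∃ p₁ ∈ T, lineU p₁ = lineU p := by
    by_contra! hno
    have := hS (Function.update 0 (lineU p) 1) 0 (fun s hs => ?_) p hp
    · simp at this
    · by_cases h : s ∈ T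
      · simpa [Function.update_of_ne (hno s h)] using respectsSides_zero s
      · exact free s hs h _ _
  have hV : ∃ p₂ ∈ T, lineV p₂ = lineV p := by
    by_contra! hno
    have := hS 0 (Function.update 0 (lineV p) 1) (fun s hs => ?_) p hp
    · simp at this
    · by_cases h : s ∈ T
      · simpa [Function.update_of_ne (hno s h)] using respectsSides_zero s
      · exact free s hs h _ _
  obtain ⟨p₁, hp₁, h₁⟩ := hU
  obtain ⟨p₂, hp₂, h₂⟩ := hV
  have hne (s : Pt) (hs : s ∈ T) : s ∈ S.erase p :=
    Finset.mem_erase.2 ⟨fun h => hpT (h ▸ hs), hTS hs⟩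
  refine .inr ⟨p₁, hne p₁ hp₁, p₂, hne p₂ hp₂, ?_, h₁, h₂, hd p₁ hp₁, hd p₂ hp₂⟩
  rintro rfl
  apply hpT
  convert hp₁ using 1
  simp only [lineU, lineV] at h₁ h₂
  ext <;> linarith

theorem denDvd_of_mul_eq {x : ℝ} {D : ℕ} (hD : D ≠ 0) {m : ℤ} (h : x * D = m) : DenDvd x D := by
  refine ⟨Rat.divInt m D, ?_, ?_⟩
  · rw [Rat.divInt_eq_div]
    push_cast
    rw [← h]
    field_simp
  · exact_mod_cast Rat.den_dvd m D

theorem DenDvd.exists_mul_eq {x : ℝ} {D : ℕ} (h : DenDvd x D) : ∃ m : ℤ, x * D = m := by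
  obtain ⟨p, rfl, k, rfl⟩ := h
  refine ⟨p.num * k, ?_⟩
  have : (p : ℝ) * p.den = p.num := by exact_mod_cast Rat.mul_den_eq_num p
  push_cast
  rw [← this]
  ring

theorem IsDyadicPt.ptDenDvd {k : ℕ} {p : Pt} (hp : IsDyadicPt k p) : PtDenDvd p (2 ^ k) := by
  obtain ⟨⟨m, hm⟩, n, hn⟩ := hp
  exact ⟨denDvd_of_mul_eq (by positivity) (m := m) (by exact_mod_cast hm),
    denDvd_of_mul_eq (by positivity) (m := n) (by exact_mod_cast hn)⟩

theorem PtDenDvd.mono {p : Pt} {D D' : ℕ} (hD : D ∣ D') (hp : PtDenDvd p D) : PtDenDvd p D' := by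
  obtain ⟨⟨a, ha, ha'⟩, b, hb, hb'⟩ := hp
  exact ⟨⟨a, ha, ha'.trans hD⟩, b, hb, hb'.trans hD⟩

theorem ptDenDvd_of_crossing {k : ℕ} {p p₁ p₂ : Pt} (h₁ : IsDyadicPt k p₁) (h₂ : IsDyadicPt k p₂)
    (hU : lineU p₁ = lineU p) (hV : lineV p₂ = lineV p) : PtDenDvd p (3 * 2 ^ k) := by
  obtain ⟨⟨a, ha⟩, b, hb⟩ := h₁
  obtain ⟨⟨c, hc⟩, d, hd⟩ := h₂
  simp only [lineU, lineV] at hU hV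
  refine ⟨denDvd_of_mul_eq (by positivity) (m := 2 * (2 * a - b) - (c - 2 * d)) ?_,
    denDvd_of_mul_eq (by positivity) (m := (2 * a - b) - 2 * (c - 2 * d)) ?_⟩ <;>
  · push_cast
    rw [← ha, ← hb, ← hc, ← hd]
    first
    | linear_combination (2 * 2 ^ k) * (-hU) + 2 ^ k * hV
    | linear_combination (2 ^ k) * (-hU) + 2 * 2 ^ k * hV

theorem confDot_unitVec {q : ℕ} (i : Fin q) (v : Pt) (w : Conf q) :
    confDot (unitVec i v) w = dotp v (w i) := by
  rw [confDot, Finset.sum_eq_single i]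
  · simp [unitVec]
  · intro k _ hk
    simp [unitVec, hk, dotp]
  · simp

theorem confDot_attackNormal {q : ℕ} {i j : Fin q} (hij : i ≠ j) (v : Pt) (w : Conf q) :
    confDot (attackNormal i j v) w = dotp v (w i) - dotp v (w j) := by
  have h : attackNormal i j v = unitVec i v + unitVec j (-v) := by
    funext k
    simp only [attackNormal, unitVec, Pi.add_apply]
    split_ifs with h1 h2 <;> simp_all
  have hadd : confDot (unitVec i v + unitVec j (-v)) w =
      confDot (unitVec i v) w + confDot (unitVec j (-v)) w := by
    simp only [confDot, ← Finset.sum_add_distrib, dotp, Pi.add_apply, Prod.fst_add, Prod.snd_add]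
    exact Finset.sum_congr rfl fun k _ => by ring
  rw [h, hadd, confDot_unitVec, confDot_unitVec]
  simp only [dotp, Prod.fst_neg, Prod.snd_neg]
  ring

theorem confDot_of_mem_HArr {Bd : Board} {P : Piece} {q : ℕ} {z : Conf q} {h : Conf q × ℝ}
    (hh : h ∈ HArr Bd P z) : confDot h.1 z = h.2 := by
  rcases hh with ⟨i, j, r, hij, h0, rfl⟩ | ⟨i, e, he, rfl⟩
  · rw [confDot_attackNormal hij.ne]
    simp only [dotp, Prod.fst_sub, Prod.snd_sub] at h0 ⊢
    linarith
  · rw [confDot_unitVec, he]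

theorem dotp_le_of_mem_unitSq {Bd : Board} (hBd : Bd.set = unitSq) (e : Fin Bd.s)
    {p : Pt} (hp : p ∈ unitSq) :
    dotp (Bd.A e) p ≤ Bd.β e := by
  rw [← hBd] at hp
  exact hp e

/-- Displacements preserving the sides of the square through `p` preserve the defining lines of
the board through `p`. -/
theorem dotp_eq_zero_of_sides {Bd : Board} (hBd : Bd.set = unitSq) (e : Fin Bd.s)
    {p δ : Pt} (hp : p ∈ unitSq)
    (he : dotp (Bd.A e) p = Bd.β e) (hx : OnVert p → δ.1 = 0) (hy : OnHoriz p → δ.2 = 0) :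
    dotp (Bd.A e) δ = 0 := by
  have vert (s : Pt) (hs : s ∈ unitSq) (hse : dotp (Bd.A e) s = Bd.β e) (hA : (Bd.A e).1 ≠ 0) :
      (0 < (Bd.A e).1 → s.1 = 1) ∧ ((Bd.A e).1 < 0 → s.1 = 0) := by
    obtain ⟨⟨a1, a2⟩, b1, b2⟩ := mem_unitSq.1 hs
    have l := dotp_le_of_mem_unitSq hBd e (p := (0, s.2)) (mem_unitSq.2 (by simp [b1, b2]))
    have r := dotp_le_of_mem_unitSq hBd e (p := (1, s.2)) (mem_unitSq.2 (by simp [b1, b2]))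
    simp only [dotp] at hse l r
    exact ⟨fun h => by nlinarith, fun h => by nlinarith⟩
  have horiz (s : Pt) (hs : s ∈ unitSq) (hse : dotp (Bd.A e) s = Bd.β e) (hA : (Bd.A e).2 ≠ 0) :
      (0 < (Bd.A e).2 → s.2 = 1) ∧ ((Bd.A e).2 < 0 → s.2 = 0) := by
    obtain ⟨⟨a1, a2⟩, b1, b2⟩ := mem_unitSq.1 hs
    have l := dotp_le_of_mem_unitSq hBd e (p := (s.1, 0)) (mem_unitSq.2 (by simp [a1, a2]))
    have r := dotp_le_of_mem_unitSq hBd e (p := (s.1, 1)) (mem_unitSq.2 (by simp [a1, a2]))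
    simp only [dotp] at hse l r
    exact ⟨fun h => by nlinarith, fun h => by nlinarith⟩
  have hzero : (Bd.A e).1 = 0 ∨ (Bd.A e).2 = 0 := by
    by_contra! hne
    obtain ⟨u, v, huv, hu, hv, hue, hve⟩ := Bd.edges e
    have hu' : u ∈ unitSq := hBd ▸ hu
    have hv' : v ∈ unitSq := hBd ▸ hv
    have hux := vert u hu' hue hne.1
    have hvx := vert v hv' hve hne.1
    have huy := horiz u hu' hue hne.2
    have hvy := horiz v hv' hve hne.2
    refine huv (Prod.ext ?_ ?_)
    · rcases lt_or_gt_of_ne hne.1 with h | h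
      · rw [hux.2 h, hvx.2 h]
      · rw [hux.1 h, hvx.1 h]
    · rcases lt_or_gt_of_ne hne.2 with h | h
      · rw [huy.2 h, hvy.2 h]
      · rw [huy.1 h, hvy.1 h]
  have hX : (Bd.A e).1 * δ.1 = 0 := by
    by_cases h0 : (Bd.A e).1 = 0
    · simp [h0]
    have := vert p hp he h0
    have hv : OnVert p :=
      (lt_or_gt_of_ne h0).elim (fun h => .inl (this.2 h)) fun h => .inr (this.1 h)
    simp [hx hv]
  have hY : (Bd.A e).2 * δ.2 = 0 := by
    by_cases h0 : (Bd.A e).2 = 0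
    · simp [h0]
    have := horiz p hp he h0
    have hv : OnHoriz p :=
      (lt_or_gt_of_ne h0).elim (fun h => .inl (this.2 h)) fun h => .inr (this.1 h)
    simp [hy hv]
  simp [dotp, hX, hY]

/-- A defining line of the board blocks every exit from the square. -/
theorem exists_blocking_line {Bd : Board} (hBd : Bd.set = unitSq) {m n : Pt} (hm : m ∈ unitSq)
    (hn : ∀ s : ℝ, 0 < s → m + s • n ∉ unitSq) :
    ∃ e, dotp (Bd.A e) m = Bd.β e ∧ 0 < dotp (Bd.A e) n := by
  by_contra! hno
  have hev : ∀ᶠ s : ℝ in nhdsWithin 0 (Set.Ioi 0), ∀ e, dotp (Bd.A e) (m + s • n) ≤ Bd.β e := by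
    rw [Filter.eventually_all]
    intro e
    have hform (s : ℝ) :
        dotp (Bd.A e) (m + s • n) = dotp (Bd.A e) m + s * dotp (Bd.A e) n := by
      simp only [dotp, Prod.fst_add, Prod.snd_add, Prod.smul_fst, Prod.smul_snd, smul_eq_mul]
      ring
    rcases (dotp_le_of_mem_unitSq hBd e hm).lt_or_eq with hlt | heq
    · have hcont : Continuous fun s : ℝ => dotp (Bd.A e) m + s * dotp (Bd.A e) n := by fun_prop
      have := (hcont.tendsto 0).eventually_lt_const (by simpa using hlt)
      filter_upwards [nhdsWithin_le_nhds this] with s hs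
      rw [hform]
      exact hs.le
    · filter_upwards [self_mem_nhdsWithin] with s hs
      rw [hform, heq]
      have := mul_nonpos_of_nonneg_of_nonpos (le_of_lt hs) (hno e heq)
      linarith
  obtain ⟨s, hs, hs0⟩ := (hev.and self_mem_nhdsWithin).exists
  exact hn s hs0 (hBd ▸ hs)

theorem exists_vert_line {Bd : Board} (hBd : Bd.set = unitSq) {c : ℝ} (hc : c = 0 ∨ c = 1) :
    ∃ e, ∃ α : ℝ, α ≠ 0 ∧ Bd.A e = (α, 0) ∧ Bd.β e = α * c := by
  have hm : ((c, 1 / 2) : Pt) ∈ unitSq := mem_unitSq.2 (by rcases hc with rfl | rfl <;> norm_num)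
  obtain ⟨e, he, hpos⟩ := exists_blocking_line hBd (n := (2 * c - 1, 0)) hm (by
    intro s hs h
    have := mem_unitSq.1 h
    rcases hc with rfl | rfl <;> norm_num at this <;> linarith)
  have h0 := dotp_le_of_mem_unitSq hBd e (p := (c, 0))
    (mem_unitSq.2 (by rcases hc with rfl | rfl <;> norm_num))
  have h1 := dotp_le_of_mem_unitSq hBd e (p := (c, 1))
    (mem_unitSq.2 (by rcases hc with rfl | rfl <;> norm_num))
  simp only [dotp] at he hpos h0 h1
  have hz : (Bd.A e).2 = 0 := by linarith
  refine ⟨e, (Bd.A e).1, ?_, Prod.ext rfl hz, ?_⟩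
  · intro h
    simp [h] at hpos
  · rw [← he, hz]
    ring

theorem exists_horiz_line {Bd : Board} (hBd : Bd.set = unitSq) {c : ℝ} (hc : c = 0 ∨ c = 1) :
    ∃ e, ∃ α : ℝ, α ≠ 0 ∧ Bd.A e = (0, α) ∧ Bd.β e = α * c := by
  have hm : ((1 / 2, c) : Pt) ∈ unitSq := mem_unitSq.2 (by rcases hc with rfl | rfl <;> norm_num)
  obtain ⟨e, he, hpos⟩ := exists_blocking_line hBd (n := (0, 2 * c - 1)) hm (by
    intro s hs h
    have := mem_unitSq.1 h
    rcases hc with rfl | rfl <;> norm_num at this <;> linarith)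
  have h0 := dotp_le_of_mem_unitSq hBd e (p := (0, c))
    (mem_unitSq.2 (by rcases hc with rfl | rfl <;> norm_num))
  have h1 := dotp_le_of_mem_unitSq hBd e (p := (1, c))
    (mem_unitSq.2 (by rcases hc with rfl | rfl <;> norm_num))
  simp only [dotp] at he hpos h0 h1
  have hz : (Bd.A e).1 = 0 := by linarith
  refine ⟨e, (Bd.A e).2, ?_, Prod.ext hz rfl, ?_⟩
  · intro h
    simp [h] at hpos
  · rw [← he, hz]
    ring

/-- The inclined nightrider: the rider with moves `(1,2)` and `(2,1)`. -/
structure IsInclinedNightrider (P : Piece) : Prop where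
  dotp_anorm_false : ∀ v : Pt, dotp v (P.anorm false) = lineU v
  dotp_anorm_true : ∀ v : Pt, dotp v (P.anorm true) = lineV v

theorem isInclinedNightrider_of_moves {P : Piece} (h1 : P.c false = 1) (h2 : P.d false = 2)
    (h3 : P.c true = 2) (h4 : P.d true = 1) : IsInclinedNightrider P := by
  constructor <;> intro v <;> simp [dotp, Piece.anorm, lineU, lineV, h1, h2, h3, h4] <;> ring

theorem dotp_comm (u v : Pt) : dotp u v = dotp v u := by
  simp only [dotp]
  ring

theorem lineU_sub (p p' : Pt) : lineU (p - p') = lineU p - lineU p' := by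
  simp only [lineU, Prod.fst_sub, Prod.snd_sub]
  ring

theorem lineV_sub (p p' : Pt) : lineV (p - p') = lineV p - lineV p' := by
  simp only [lineV, Prod.fst_sub, Prod.snd_sub]
  ring

/-- The positions occupied by a vertex form a rigid set. -/
theorem IsVertex.isRigidSet {Bd : Board} (hBd : Bd.set = unitSq) {P : Piece}
    (hP : IsInclinedNightrider P) {q : ℕ} {z : Conf q} (hz : IsVertex Bd P z) :
    IsRigidSet lineU lineV RespectsSides (Finset.univ.image z) := by
  obtain ⟨hin, H', hH', hset⟩ := hz
  intro a b hab p hp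
  have hab' (i : Fin q) := hab (z i) (Finset.mem_image_of_mem z (Finset.mem_univ i))
  set δ : Conf q := fun i =>
    ((2 * a (lineU (z i)) - b (lineV (z i))) / 3, (a (lineU (z i)) - 2 * b (lineV (z i))) / 3)
    with hδ
  have hU (i : Fin q) : lineU (δ i) = a (lineU (z i)) := by simp only [hδ, lineU]; ring
  have hV (i : Fin q) : lineV (δ i) = b (lineV (z i)) := by simp only [hδ, lineV]; ring
  have hdot (v u w : Pt) : dotp v (u + w) = dotp v u + dotp v w := by
    simp only [dotp, Prod.fst_add, Prod.snd_add]
    ring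
  have hw : z + δ ∈ ({z} : Set (Conf q)) := by
    rw [← hset]
    intro h hh
    have hzero := confDot_of_mem_HArr (hH' hh)
    rcases hH' hh with ⟨i, j, r, hij, h0, rfl⟩ | ⟨i, e, he, rfl⟩
    · rw [confDot_attackNormal hij.ne] at hzero ⊢
      simp only [Pi.add_apply, hdot]
      have : dotp (P.anorm r) (δ i) = dotp (P.anorm r) (δ j) := by
        rw [dotp_comm _ (δ i), dotp_comm _ (δ j)]
        cases r
        · rw [hP.dotp_anorm_false, lineU_sub, sub_eq_zero] at h0
          rw [hP.dotp_anorm_false, hP.dotp_anorm_false, hU, hU, h0]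
        · rw [hP.dotp_anorm_true, lineV_sub, sub_eq_zero] at h0
          rw [hP.dotp_anorm_true, hP.dotp_anorm_true, hV, hV, h0]
      linarith
    · rw [confDot_unitVec, Pi.add_apply, hdot, he, dotp_eq_zero_of_sides hBd e (hBd ▸ hin i) he,
        add_zero]
      · intro hv
        simp only [hδ]
        linarith [(hab' i).1 hv]
      · intro hv
        simp only [hδ]
        linarith [(hab' i).2 hv]
  obtain ⟨i, -, rfl⟩ := Finset.mem_image.1 hp
  have hδ0 : δ i = 0 := by simpa using congrFun (Set.mem_singleton_iff.1 hw) i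
  rw [← hU, ← hV, hδ0]
  simp [lineU, lineV]

/-- A configuration in the square determined by its coincident move lines and its sides is a
vertex. -/
theorem isVertex_of_unique {Bd : Board} (hBd : Bd.set = unitSq) {P : Piece}
    (hP : IsInclinedNightrider P) {q : ℕ} {z : Conf q} (hz : ∀ i, z i ∈ unitSq)
    (huniq : ∀ w : Conf q,
      (∀ i j, lineU (z i) = lineU (z j) → lineU (w i) = lineU (w j)) →
      (∀ i j, lineV (z i) = lineV (z j) → lineV (w i) = lineV (w j)) →
      (∀ i, OnVert (z i) → (w i).1 = (z i).1) →
      (∀ i, OnHoriz (z i) → (w i).2 = (z i).2) → w = z) :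
    IsVertex Bd P z := by
  refine ⟨fun i => hBd ▸ hz i, HArr Bd P z, subset_rfl, ?_⟩
  refine Set.Subset.antisymm (fun w hw => ?_) ?_
  · have attack (r : Bool) (i j : Fin q) (h : dotp (z i - z j) (P.anorm r) = 0) :
        dotp (w i - w j) (P.anorm r) = 0 := by
      have key (i j : Fin q) (hij : i < j) (h : dotp (z i - z j) (P.anorm r) = 0) :
          dotp (w i - w j) (P.anorm r) = 0 := by
        have := hw _ (.inl ⟨i, j, r, hij, h, rfl⟩)
        rw [confDot_attackNormal hij.ne] at this
        simp only [dotp, Prod.fst_sub, Prod.snd_sub] at this ⊢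
        linarith
      rcases lt_trichotomy i j with hij | rfl | hij
      · exact key i j hij h
      · simp [dotp]
      · have := key j i hij (by simp only [dotp, Prod.fst_sub, Prod.snd_sub] at h ⊢; linarith)
        simp only [dotp, Prod.fst_sub, Prod.snd_sub] at this ⊢
        linarith
    refine huniq w (fun i j h => ?_) (fun i j h => ?_) (fun i h => ?_) fun i h => ?_
    · have := attack false i j
      rw [hP.dotp_anorm_false, hP.dotp_anorm_false, lineU_sub, lineU_sub] at this
      exact sub_eq_zero.1 (this (sub_eq_zero.2 h))
    · have := attack true i j
      rw [hP.dotp_anorm_true, hP.dotp_anorm_true, lineV_sub, lineV_sub] at this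
      exact sub_eq_zero.1 (this (sub_eq_zero.2 h))
    · obtain ⟨e, α, hα, hA, hβ⟩ := exists_vert_line hBd h
      have := hw _ (.inr ⟨i, e, by rw [hA, hβ]; simp [dotp], rfl⟩)
      rw [confDot_unitVec, hA, hβ] at this
      simpa [dotp, hα] using this
    · obtain ⟨e, α, hα, hA, hβ⟩ := exists_horiz_line hBd h
      have := hw _ (.inr ⟨i, e, by rw [hA, hβ]; simp [dotp], rfl⟩)
      rw [confDot_unitVec, hA, hβ] at this
      simpa [dotp, hα] using this
  · rintro _ rfl h hh
    exact confDot_of_mem_HArr hh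

/-- The trajectory starting at the corner `(0,0)` with the move `(1,2)` and converging to the
corner `(0,1)`. -/
def cornerTraj (k : ℕ) : Pt :=
  if Even k then (0, 1 - (1 / 2) ^ k) else ((1 / 2) ^ k, 1)

theorem isVertex_cornerTraj {Bd : Board} (hBd : Bd.set = unitSq) {P : Piece}
    (hP : IsInclinedNightrider P) (q : ℕ) :
    IsVertex Bd P (fun i : Fin q => cornerTraj i) := by
  refine isVertex_of_unique hBd hP (fun i => ?_) fun w hU hV hx hy => ?_
  · have h0 : (0 : ℝ) ≤ (1 / 2) ^ (i : ℕ) := by positivity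
    have h1 : ((1 : ℝ) / 2) ^ (i : ℕ) ≤ 1 := pow_le_one₀ (by norm_num) (by norm_num)
    rw [mem_unitSq, cornerTraj]
    split_ifs <;> simp only [] <;> refine ⟨⟨?_, ?_⟩, ?_, ?_⟩ <;> linarith
  · suffices h : ∀ k (hk : k < q), w ⟨k, hk⟩ = cornerTraj k from funext fun i => h i i.2
    intro k
    induction k with
    | zero =>
      intro hk
      have h1 := hx ⟨0, hk⟩ (.inl (by simp [cornerTraj]))
      have h2 := hy ⟨0, hk⟩ (.inl (by simp [cornerTraj]))
      exact Prod.ext h1 h2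
    | succ k ih =>
      intro hk
      have hwk := ih (by omega)
      have hU' := hU ⟨k + 1, hk⟩ ⟨k, by omega⟩
      have hV' := hV ⟨k + 1, hk⟩ ⟨k, by omega⟩
      have hx' := hx ⟨k + 1, hk⟩
      have hy' := hy ⟨k + 1, hk⟩
      rw [hwk] at hU' hV'
      have hpow : ((1 : ℝ) / 2) ^ (k + 1) = (1 / 2) ^ k / 2 := by ring
      by_cases he : Even k
      · have ho : ¬ Even (k + 1) := by simpa [Nat.even_add_one] using he
        simp only [cornerTraj, he, ho, if_true, if_false, lineU, OnHoriz, hpow]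
          at hU' hy' ⊢
        have hb := hy' (.inr trivial)
        have hu := hU' (by ring)
        exact Prod.ext (by simp only; linarith) hb
      · have ho : Even (k + 1) := by simpa [Nat.even_add_one] using he
        simp only [cornerTraj, he, ho, if_true, if_false, lineV, OnVert, hpow]
          at hV' hx' ⊢
        have hb := hx' (.inl trivial)
        have hv := hV' (by ring)
        exact Prod.ext hb (by simp only; linarith)

theorem two_pow_dvd_of_ptDenDvd_cornerTraj {k D : ℕ} (h : PtDenDvd (cornerTraj k) D) :
    2 ^ k ∣ D := by
  have key : ∃ m : ℤ, ((1 : ℝ) / 2) ^ k * D = m := by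
    obtain ⟨h1, h2⟩ := h
    rw [cornerTraj] at h1 h2
    split_ifs at h1 h2
    · obtain ⟨m, hm⟩ := h2.exists_mul_eq
      refine ⟨D - m, ?_⟩
      push_cast
      rw [← hm]
      ring
    · exact h1.exists_mul_eq
  obtain ⟨m, hm⟩ := key
  have : ((D : ℤ) : ℝ) = ((2 ^ k : ℕ) * m : ℤ) := by
    push_cast
    rw [← hm, ← mul_assoc, ← mul_pow]
    norm_num
  exact Int.natCast_dvd_natCast.1 ⟨m, by exact_mod_cast this⟩

/-- Two opposite corners together with copies of an intersection of their move lines. -/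
def cornerCrossing : ℕ → Pt
  | 0 => (0, 0)
  | 1 => (1, 1)
  | _ => (1 / 3, 2 / 3)

theorem isVertex_cornerCrossing {Bd : Board} (hBd : Bd.set = unitSq) {P : Piece}
    (hP : IsInclinedNightrider P) {q : ℕ} (hq : 2 ≤ q) :
    IsVertex Bd P (fun i : Fin q => cornerCrossing i) := by
  have c0 : cornerCrossing 0 = (0, 0) := rfl
  have c1 : cornerCrossing 1 = (1, 1) := rfl
  have c2 (k : ℕ) : cornerCrossing (k + 2) = (1 / 3, 2 / 3) := rfl
  refine isVertex_of_unique hBd hP (fun i => ?_) fun w hU hV hx hy => ?_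
  · obtain ⟨k, hk⟩ := i
    rw [mem_unitSq]
    rcases k with _ | _ | k <;> norm_num [c0, c1, c2]
  · have w0 : w ⟨0, by omega⟩ = (0, 0) := Prod.ext
      ((hx _ (.inl (by simp [c0]))).trans (by simp [c0]))
      ((hy _ (.inl (by simp [c0]))).trans (by simp [c0]))
    have w1 : w ⟨1, by omega⟩ = (1, 1) := Prod.ext
      ((hx _ (.inr (by simp [c1]))).trans (by simp [c1]))
      ((hy _ (.inr (by simp [c1]))).trans (by simp [c1]))
    funext i
    obtain ⟨k, hk⟩ := i
    rcases k with _ | _ | k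
    · exact w0
    · exact w1
    · have hu := hU ⟨k + 2, hk⟩ ⟨0, by omega⟩ (by norm_num [c0, c2, lineU])
      have hv := hV ⟨k + 2, hk⟩ ⟨1, by omega⟩ (by norm_num [c1, c2, lineV])
      rw [w0] at hu
      rw [w1] at hv
      simp only [lineU, lineV] at hu hv
      change w ⟨k + 2, hk⟩ = (1 / 3, 2 / 3)
      exact Prod.ext (by dsimp only; linarith) (by dsimp only; linarith)

theorem three_dvd_of_denDvd {D : ℕ} (h : DenDvd (1 / 3) D) : 3 ∣ D := by
  obtain ⟨m, hm⟩ := h.exists_mul_eq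
  have : ((D : ℤ) : ℝ) = ((3 : ℕ) * m : ℤ) := by
    push_cast
    rw [← hm]
    ring
  exact Int.natCast_dvd_natCast.1 ⟨m, by exact_mod_cast this⟩

theorem IsVertex.ptDenDvd {Bd : Board} (hBd : Bd.set = unitSq) {P : Piece}
    (hP : IsInclinedNightrider P) {q : ℕ} {z : Conf q} (hz : IsVertex Bd P z) (i : Fin q) :
    PtDenDvd (z i) (if q ≤ 2 then 2 ^ (q - 1) else 3 * 2 ^ (q - 1)) := by
  have hsq : ∀ p ∈ Finset.univ.image z, p ∈ unitSq := by
    intro p hp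
    obtain ⟨j, -, rfl⟩ := Finset.mem_image.1 hp
    exact hBd ▸ hz.1 j
  have hcard : (Finset.univ.image z).card ≤ q := by
    simpa using Finset.card_image_le (s := Finset.univ) (f := z)
  have hle : (Finset.univ.image z).card - 1 ≤ q - 1 := Nat.sub_le_sub_right hcard 1
  have hzi : z i ∈ Finset.univ.image z := Finset.mem_image_of_mem z (Finset.mem_univ i)
  rcases (hz.isRigidSet hBd hP).boundary_or_crossing hsq hzi with
    hd | ⟨p₁, hp₁, p₂, hp₂, hne, hU, hV, hd₁, hd₂⟩
  · refine (hd.mono hle).ptDenDvd.mono ?_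
    split_ifs
    · exact dvd_rfl
    · exact dvd_mul_left _ _
  · have h2 : 1 < ((Finset.univ.image z).erase (z i)).card :=
      Finset.one_lt_card.2 ⟨p₁, hp₁, p₂, hp₂, hne⟩
    rw [Finset.card_erase_of_mem hzi] at h2
    rw [if_neg (by omega)]
    exact ptDenDvd_of_crossing (hd₁.mono hle) (hd₂.mono hle) hU hV

/-- The denominator of the inside-out polytope for the inclined nightrider, with moves
`(1,2)` and `(2,1)`, on the square board. -/
theorem iopDenom_inclined_nightrider (Bd : Board) (hBd : Bd.set = unitSq)
    (P : Piece) (h1 : P.c false = 1) (h2 : P.d false = 2)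
    (h3 : P.c true = 2) (h4 : P.d true = 1)
    (q : ℕ) (hq : 1 ≤ q) :
    IsIOPDenom Bd P q
      (if q = 1 then 1 else if q = 2 then 2 else 3 * 2 ^ (q - 1)) := by
  have hP := isInclinedNightrider_of_moves h1 h2 h3 h4
  have hD : (if q = 1 then 1 else if q = 2 then 2 else 3 * 2 ^ (q - 1)) =
      if q ≤ 2 then 2 ^ (q - 1) else 3 * 2 ^ (q - 1) := by
    by_cases hq2 : q ≤ 2
    · interval_cases q <;> rfl
    · rw [if_neg (by omega), if_neg (by omega), if_neg hq2]
  rw [hD]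
  refine ⟨fun z hz i => hz.ptDenDvd hBd hP i, fun D' hD' => ?_⟩
  have hpow : 2 ^ (q - 1) ∣ D' := two_pow_dvd_of_ptDenDvd_cornerTraj
    (hD' _ (isVertex_cornerTraj hBd hP q) ⟨q - 1, by omega⟩)
  split_ifs with hq2
  · exact hpow
  · refine Nat.Coprime.mul_dvd_of_dvd_of_dvd (Nat.Coprime.pow_right _ (by norm_num)) ?_ hpow
    have := hD' _ (isVertex_cornerCrossing hBd hP (by omega : 2 ≤ q)) ⟨2, by omega⟩
    exact three_dvd_of_denDvd (by simpa [cornerCrossing] using this.1)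

end
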